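/- arXiv:0709.1420 — 2 statements merged into one kernel-verified Lean document; each statement's English description precedes it below -/
import Mathlib

section
/- Let f be in the Bloch space of the unit polydisc U^n (i.e. f is holomorphic on U^n with ‖f‖ = |f(0)| + sup_{z∈U^n} Σ_{j=1}^n (1−|z_j|²)|∂f/∂z_j(z)| finite). Then for all z, w ∈ U^n, |f(z) − f(w)| ≤ n² ‖f‖ k_{U^n}(z, w). -/
open Complex Metric Set Filter
open scoped Topology BigOperators

noncomputable section

/-- The unit polydisc `U^n` in `ℂ^n`; the norm on `Fin n → ℂ` is the sup norm
`|||z||| = max_j |z_j|`. -/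
def polyDisc (n : ℕ) : Set (Fin n → ℂ) := {z | ‖z‖ < 1}

/-- `Σ_{j=1}^n (1 - |z_j|²) |∂f/∂z_j(z)|`. -/
def blochSum (n : ℕ) (f : (Fin n → ℂ) → ℂ) (z : Fin n → ℂ) : ℝ :=
  ∑ j : Fin n, (1 - ‖z j‖ ^ 2) * ‖fderiv ℂ f z (Pi.single j 1)‖

/-- The Bloch norm `‖f‖ = |f(0)| + sup_{z ∈ Uⁿ} Σ_j (1-|z_j|²)|∂f/∂z_j(z)|`. -/
def blochNorm (n : ℕ) (f : (Fin n → ℂ) → ℂ) : ℝ :=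
  ‖f 0‖ + sSup (blochSum n f '' polyDisc n)

/-- The Möbius automorphism `φ_a` of the polydisc:
`φ_a(w)_j = (w_j - a_j)/(1 - conj(a_j) w_j)`. -/
def mobius (n : ℕ) (a w : Fin n → ℂ) : Fin n → ℂ :=
  fun j => (w j - a j) / (1 - (starRingEnd ℂ) (a j) * w j)

/-- The Kobayashi distance on the polydisc:
`k_{Uⁿ}(z,w) = (1/2) log((1 + |||φ_z(w)|||)/(1 - |||φ_z(w)|||))`. -/
def kobayashi (n : ℕ) (z w : Fin n → ℂ) : ℝ :=
  (1 / 2) * Real.log ((1 + ‖mobius n z w‖) / (1 - ‖mobius n z w‖))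

lemma mem_polyDisc {n : ℕ} {z : Fin n → ℂ} : z ∈ polyDisc n ↔ ∀ j, ‖z j‖ < 1 :=
  pi_norm_lt_iff one_pos

lemma isOpen_polyDisc (n : ℕ) : IsOpen (polyDisc n) :=
  isOpen_lt continuous_norm continuous_const

lemma one_sub_conj_mul_ne_zero {a w : ℂ} (ha : ‖a‖ < 1) (hw : ‖w‖ < 1) :
    1 - (starRingEnd ℂ) a * w ≠ 0 := by
  intro h
  have h1 : ‖(starRingEnd ℂ) a * w‖ = 1 := by rw [← sub_eq_zero.mp h, norm_one]
  rw [norm_mul, RCLike.norm_conj] at h1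
  nlinarith [norm_nonneg a, norm_nonneg w]

lemma norm_one_sub_conj_mul_sq_sub (a w : ℂ) :
    ‖1 - (starRingEnd ℂ) a * w‖ ^ 2 - ‖w - a‖ ^ 2 = (1 - ‖a‖ ^ 2) * (1 - ‖w‖ ^ 2) := by
  simp only [← Complex.normSq_eq_norm_sq, Complex.normSq_apply, Complex.sub_re, Complex.sub_im,
    Complex.mul_re, Complex.mul_im, Complex.conj_re, Complex.conj_im, Complex.one_re,
    Complex.one_im]
  ring

lemma one_sub_norm_mobius_sq {n : ℕ} {a w : Fin n → ℂ} (ha : a ∈ polyDisc n)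
    (hw : w ∈ polyDisc n) (j : Fin n) :
    1 - ‖mobius n a w j‖ ^ 2 =
      (1 - ‖a j‖ ^ 2) * (1 - ‖w j‖ ^ 2) / ‖1 - (starRingEnd ℂ) (a j) * w j‖ ^ 2 := by
  have h := one_sub_conj_mul_ne_zero (mem_polyDisc.mp ha j) (mem_polyDisc.mp hw j)
  rw [← norm_one_sub_conj_mul_sq_sub, mobius, norm_div, div_pow, sub_div,
    div_self (pow_ne_zero 2 (norm_ne_zero_iff.mpr h))]

lemma one_sub_norm_sq_pos {n : ℕ} {a : Fin n → ℂ} (ha : a ∈ polyDisc n) (j : Fin n) :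
    0 < 1 - ‖a j‖ ^ 2 := by
  nlinarith [norm_nonneg (a j), mem_polyDisc.mp ha j]

lemma mobius_mem_polyDisc {n : ℕ} {a w : Fin n → ℂ} (ha : a ∈ polyDisc n)
    (hw : w ∈ polyDisc n) : mobius n a w ∈ polyDisc n := by
  refine mem_polyDisc.mpr fun j => ?_
  have h := one_sub_conj_mul_ne_zero (mem_polyDisc.mp ha j) (mem_polyDisc.mp hw j)
  have hpos : 0 < 1 - ‖mobius n a w j‖ ^ 2 := by
    rw [one_sub_norm_mobius_sq ha hw]
    have := one_sub_norm_sq_pos ha j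
    have := one_sub_norm_sq_pos hw j
    have := norm_pos_iff.mpr h
    positivity
  nlinarith [norm_nonneg (mobius n a w j)]

lemma neg_mem_polyDisc {n : ℕ} {a : Fin n → ℂ} (ha : a ∈ polyDisc n) : -a ∈ polyDisc n := by
  simpa [polyDisc] using ha

lemma mobius_neg_zero {n : ℕ} (a : Fin n → ℂ) : mobius n (-a) 0 = a := by
  ext j
  simp [mobius]

lemma mobius_neg_mobius {n : ℕ} {a w : Fin n → ℂ} (ha : a ∈ polyDisc n)
    (hw : w ∈ polyDisc n) : mobius n (-a) (mobius n a w) = w := by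
  ext j
  have h := one_sub_conj_mul_ne_zero (mem_polyDisc.mp ha j) (mem_polyDisc.mp hw j)
  have h1 := one_sub_conj_mul_ne_zero (mem_polyDisc.mp (neg_mem_polyDisc ha) j)
    (mem_polyDisc.mp (mobius_mem_polyDisc ha hw) j)
  rw [mobius, div_eq_iff h1]
  simp only [mobius, Pi.neg_apply, map_neg]
  rw [mul_comm] at h
  field_simp
  ring

lemma hasDerivAt_mobius_smul {n : ℕ} {a m : Fin n → ℂ} {t : ℝ} (ha : a ∈ polyDisc n)
    (hm : t • m ∈ polyDisc n) :
    HasDerivAt (fun s : ℝ => mobius n a (s • m))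
      (fun j => m j * (1 - ‖a j‖ ^ 2 : ℝ) / (1 - (starRingEnd ℂ) (a j) * (t • m) j) ^ 2) t := by
  refine hasDerivAt_pi.mpr fun j => ?_
  have h := one_sub_conj_mul_ne_zero (mem_polyDisc.mp ha j) (mem_polyDisc.mp hm j)
  have hs : HasDerivAt (fun s : ℝ => (s • m) j) (m j) t := by
    simpa using (hasDerivAt_id t).smul_const (m j)
  refine ((hs.sub_const (a j)).div ((hs.const_mul ((starRingEnd ℂ) (a j))).const_sub 1)
    h).congr_deriv ?_
  have hc : ((1 - ‖a j‖ ^ 2 : ℝ) : ℂ) = 1 - (starRingEnd ℂ) (a j) * a j := by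
    rw [mul_comm, Complex.mul_conj, Complex.normSq_eq_norm_sq]
    push_cast
    rfl
  rw [hc]
  ring

lemma norm_fderiv_apply_le_sum {n : ℕ} (f : (Fin n → ℂ) → ℂ) (x v : Fin n → ℂ) :
    ‖fderiv ℂ f x v‖ ≤ ∑ j, ‖v j‖ * ‖fderiv ℂ f x (Pi.single j 1)‖ := by
  have h : fderiv ℂ f x v = ∑ j, v j * fderiv ℂ f x (Pi.single j 1) := by
    conv_lhs => rw [pi_eq_sum_univ' v]
    simp only [map_sum, map_smul, smul_eq_mul]
  rw [h]
  exact (norm_sum_le _ _).trans_eq (by simp only [norm_mul])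

lemma blochSum_nonneg {n : ℕ} (f : (Fin n → ℂ) → ℂ) {x : Fin n → ℂ} (hx : x ∈ polyDisc n) :
    0 ≤ blochSum n f x :=
  Finset.sum_nonneg fun j _ => mul_nonneg (one_sub_norm_sq_pos hx j).le (norm_nonneg _)

lemma norm_fderiv_mobius_smul_le {n : ℕ} (f : (Fin n → ℂ) → ℂ) {a m : Fin n → ℂ} {t : ℝ}
    (ha : a ∈ polyDisc n) (hm : t • m ∈ polyDisc n) :
    ‖fderiv ℂ f (mobius n a (t • m)) (fun j =>
        m j * (1 - ‖a j‖ ^ 2 : ℝ) / (1 - (starRingEnd ℂ) (a j) * (t • m) j) ^ 2)‖ ≤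
      blochSum n f (mobius n a (t • m)) * (‖m‖ / (1 - ‖t • m‖ ^ 2)) := by
  refine (norm_fderiv_apply_le_sum _ _ _).trans ?_
  rw [blochSum, Finset.sum_mul]
  refine Finset.sum_le_sum fun j _ => ?_
  rw [mul_right_comm]
  refine mul_le_mul_of_nonneg_right ?_ (norm_nonneg _)
  have h := norm_pos_iff.mpr
    (one_sub_conj_mul_ne_zero (mem_polyDisc.mp ha j) (mem_polyDisc.mp hm j))
  have h1 := one_sub_norm_sq_pos ha j
  have h2 := one_sub_norm_sq_pos hm j
  have h3 : 0 < 1 - ‖t • m‖ ^ 2 := by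
    have : ‖t • m‖ < 1 := hm
    nlinarith [norm_nonneg (t • m)]
  have key : ‖m j‖ / (1 - ‖(t • m) j‖ ^ 2) ≤ ‖m‖ / (1 - ‖t • m‖ ^ 2) := by
    gcongr
    · exact norm_le_pi_norm m j
    · exact norm_le_pi_norm (t • m) j
  calc _ = (1 - ‖mobius n a (t • m) j‖ ^ 2) * (‖m j‖ / (1 - ‖(t • m) j‖ ^ 2)) := by
        rw [one_sub_norm_mobius_sq ha hm, norm_div, norm_mul, norm_pow, Complex.norm_real,
          Real.norm_of_nonneg h1.le]
        field_simp
    _ ≤ _ := mul_le_mul_of_nonneg_left key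
        (one_sub_norm_sq_pos (mobius_mem_polyDisc ha hm) j).le

lemma hasDerivAt_half_log_div {r t : ℝ} (h : |t * r| < 1) :
    HasDerivAt (fun s : ℝ => (1 / 2) * Real.log ((1 + s * r) / (1 - s * r)))
      (r / (1 - (t * r) ^ 2)) t := by
  obtain ⟨h1, h2⟩ := abs_lt.mp h
  have hp : 0 < 1 + t * r := by linarith
  have hm : 0 < 1 - t * r := by linarith
  have hd : HasDerivAt (fun s : ℝ => s * r) r t := by
    simpa using (hasDerivAt_id t).mul_const r
  refine ((((hd.const_add 1).div (hd.const_sub 1) hm.ne').log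
    (div_pos hp hm).ne').const_mul (1 / 2)).congr_deriv ?_
  have : 1 - (t * r) ^ 2 = (1 + t * r) * (1 - t * r) := by ring
  rw [this]
  simp only [Pi.div_apply]
  field_simp
  ring

lemma norm_sub_le_sSup_blochSum_mul_kobayashi {n : ℕ} {f : (Fin n → ℂ) → ℂ}
    (hf : DifferentiableOn ℂ f (polyDisc n)) (hb : BddAbove (blochSum n f '' polyDisc n))
    {z w : Fin n → ℂ} (hz : z ∈ polyDisc n) (hw : w ∈ polyDisc n) :
    ‖f z - f w‖ ≤ sSup (blochSum n f '' polyDisc n) * kobayashi n z w := by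
  set S := sSup (blochSum n f '' polyDisc n)
  set m := mobius n z w with hm
  have hmem : ∀ t ∈ Icc (0 : ℝ) 1, t • m ∈ polyDisc n := by
    intro t ht
    have h : ‖m‖ < 1 := mobius_mem_polyDisc hz hw
    change ‖t • m‖ < 1
    rw [norm_smul, Real.norm_of_nonneg ht.1]
    nlinarith [ht.1, ht.2, norm_nonneg m]
  have hz' := neg_mem_polyDisc hz
  have hder : ∀ t ∈ Icc (0 : ℝ) 1, HasDerivAt (fun s : ℝ => f (mobius n (-z) (s • m)) - f z)
      (fderiv ℂ f (mobius n (-z) (t • m)) (fun j => m j * (1 - ‖(-z) j‖ ^ 2 : ℝ) /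
        (1 - (starRingEnd ℂ) ((-z) j) * (t • m) j) ^ 2)) t := fun t ht =>
    (((hf.differentiableAt ((isOpen_polyDisc n).mem_nhds (mobius_mem_polyDisc hz'
      (hmem t ht)))).hasFDerivAt.restrictScalars ℝ).comp_hasDerivAt t
        (hasDerivAt_mobius_smul hz' (hmem t ht))).sub_const _
  have habs : ∀ t ∈ Icc (0 : ℝ) 1, ‖t • m‖ = t * ‖m‖ := fun t ht => by
    rw [norm_smul, Real.norm_of_nonneg ht.1]
  have hB : ∀ t ∈ Icc (0 : ℝ) 1,
      HasDerivAt (fun s : ℝ => S * ((1 / 2) * Real.log ((1 + s * ‖m‖) / (1 - s * ‖m‖))))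
        (S * (‖m‖ / (1 - (t * ‖m‖) ^ 2))) t := fun t ht => by
    refine (hasDerivAt_half_log_div ?_).const_mul S
    rw [← habs t ht, abs_norm]
    exact hmem t ht
  have hmain := image_norm_le_of_norm_deriv_right_le_deriv_boundary'
    (fun t ht => (hder t ht).continuousAt.continuousWithinAt)
    (fun t ht => (hder t (Ico_subset_Icc_self ht)).hasDerivWithinAt)
    (by simp [mobius_neg_zero])
    (fun t ht => (hB t ht).continuousAt.continuousWithinAt)
    (fun t ht => (hB t (Ico_subset_Icc_self ht)).hasDerivWithinAt)
    (fun t ht => ?_) (right_mem_Icc.mpr zero_le_one)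
  · rw [norm_sub_rev]
    simpa [hm, mobius_neg_mobius hz hw, kobayashi] using hmain
  · have ht' := Ico_subset_Icc_self ht
    have hlt : ‖t • m‖ < 1 := hmem t ht'
    refine (norm_fderiv_mobius_smul_le f hz' (hmem t ht')).trans ?_
    rw [← habs t ht']
    refine mul_le_mul_of_nonneg_right
      (le_csSup hb (mem_image_of_mem _ (mobius_mem_polyDisc hz' (hmem t ht')))) ?_
    have : 0 ≤ 1 - ‖t • m‖ ^ 2 := by nlinarith [norm_nonneg (t • m)]
    positivity

lemma kobayashi_nonneg {n : ℕ} {z w : Fin n → ℂ} (hz : z ∈ polyDisc n) (hw : w ∈ polyDisc n) :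
    0 ≤ kobayashi n z w := by
  have h : ‖mobius n z w‖ < 1 := mobius_mem_polyDisc hz hw
  refine mul_nonneg (by norm_num) (Real.log_nonneg ?_)
  rw [le_div_iff₀ (by linarith)]
  linarith [norm_nonneg (mobius n z w)]

/-- **Lemma 1.** If `f` is in the Bloch space of `Uⁿ` (holomorphic on `Uⁿ`
with finite Bloch norm), then `|f(z) - f(w)| ≤ n² ‖f‖ k_{Uⁿ}(z,w)` for all `z, w ∈ Uⁿ`. -/
theorem bloch_lipschitz_kobayashi (n : ℕ) (hn : 0 < n) (f : (Fin n → ℂ) → ℂ)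
    (hf : DifferentiableOn ℂ f (polyDisc n))
    (hb : BddAbove (blochSum n f '' polyDisc n))
    (z w : Fin n → ℂ) (hz : z ∈ polyDisc n) (hw : w ∈ polyDisc n) :
    ‖f z - f w‖ ≤ (n : ℝ) ^ 2 * blochNorm n f * kobayashi n z w := by
  refine (norm_sub_le_sSup_blochSum_mul_kobayashi hf hb hz hw).trans
    (mul_le_mul_of_nonneg_right ?_ (kobayashi_nonneg hz hw))
  have hS : sSup (blochSum n f '' polyDisc n) ≤ blochNorm n f :=
    le_add_of_nonneg_left (norm_nonneg _)
  have hS0 : 0 ≤ sSup (blochSum n f '' polyDisc n) := by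
    refine Real.sSup_nonneg ?_
    rintro _ ⟨x, hx, rfl⟩
    exact blochSum_nonneg f hx
  have hn1 : (1 : ℝ) ≤ (n : ℝ) ^ 2 := one_le_pow₀ (by exact_mod_cast hn)
  nlinarith
end
end

section
/- Let f be holomorphic on the unit polydisc U^n with finite Bloch seminorm ‖f‖_B = sup_{z∈U^n} Q_f(z). Then for every z ∈ U^n, |f(z) − f(0)| ≤ n ‖f‖_B · (1/2) log((1 + |||z|||)/(1 − |||z|||)). -/
open Complex Metric Set Filter
open scoped Topology BigOperators

noncomputable section

/-- The Bergman metric quantity `H_z(u, ū) = Σ_j |u_j|²/(1-|z_j|²)²`. -/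
def bergmanH (n : ℕ) (z u : Fin n → ℂ) : ℝ :=
  ∑ j : Fin n, ‖u j‖ ^ 2 / (1 - ‖z j‖ ^ 2) ^ 2

/-- `Q_f(z) = sup { |∇f(z)·u| / H_z(u,ū)^{1/2} : u ∈ ℂⁿ, u ≠ 0 }`, where
`∇f(z)·u = (fderiv ℂ f z) u`. -/
def Qf (n : ℕ) (f : (Fin n → ℂ) → ℂ) (z : Fin n → ℂ) : ℝ :=
  sSup {s : ℝ | ∃ u : Fin n → ℂ, u ≠ 0 ∧ s = ‖fderiv ℂ f z u‖ / Real.sqrt (bergmanH n z u)}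

/-- The Bloch seminorm `‖f‖_B = sup_{z ∈ Uⁿ} Q_f(z)`. -/
def blochSemiQ (n : ℕ) (f : (Fin n → ℂ) → ℂ) : ℝ :=
  sSup (Qf n f '' polyDisc n)

lemma norm_le_sqrt_bergmanH {n : ℕ} {z : Fin n → ℂ} (hz : z ∈ polyDisc n) (u : Fin n → ℂ) :
    ‖u‖ ≤ Real.sqrt (bergmanH n z u) := by
  refine (pi_norm_le_iff_of_nonneg (Real.sqrt_nonneg _)).2 fun j => ?_
  refine Real.le_sqrt_of_sq_le ?_
  have hzj : ‖z j‖ < 1 := (norm_le_pi_norm z j).trans_lt hz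
  have h0 : 0 < 1 - ‖z j‖ ^ 2 := by nlinarith [norm_nonneg (z j)]
  have h1 : (1 - ‖z j‖ ^ 2) ^ 2 ≤ 1 := by nlinarith [sq_nonneg ‖z j‖]
  calc ‖u j‖ ^ 2 ≤ ‖u j‖ ^ 2 / (1 - ‖z j‖ ^ 2) ^ 2 := by
        rw [le_div_iff₀ (by positivity)]
        exact mul_le_of_le_one_right (by positivity) h1
    _ ≤ bergmanH n z u :=
        Finset.single_le_sum (f := fun j => ‖u j‖ ^ 2 / (1 - ‖z j‖ ^ 2) ^ 2)
          (fun i _ => by positivity) (Finset.mem_univ j)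

lemma norm_fderiv_le_Qf_mul {n : ℕ} (f : (Fin n → ℂ) → ℂ) {z : Fin n → ℂ}
    (hz : z ∈ polyDisc n) (u : Fin n → ℂ) :
    ‖fderiv ℂ f z u‖ ≤ Qf n f z * Real.sqrt (bergmanH n z u) := by
  rcases eq_or_ne u 0 with rfl | hu
  · simp [bergmanH]
  · have hpos : 0 < Real.sqrt (bergmanH n z u) :=
      (norm_pos_iff.2 hu).trans_le (norm_le_sqrt_bergmanH hz u)
    rw [← div_le_iff₀ hpos]
    refine le_csSup ⟨‖fderiv ℂ f z‖, ?_⟩ ⟨u, hu, rfl⟩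
    rintro _ ⟨v, -, rfl⟩
    refine div_le_of_le_mul₀ (Real.sqrt_nonneg _) (norm_nonneg _) ?_
    exact ((fderiv ℂ f z).le_opNorm v).trans
      (mul_le_mul_of_nonneg_left (norm_le_sqrt_bergmanH hz v) (norm_nonneg _))

lemma blochSemiQ_nonneg (n : ℕ) (f : (Fin n → ℂ) → ℂ) : 0 ≤ blochSemiQ n f := by
  refine Real.sSup_nonneg ?_
  rintro _ ⟨z, -, rfl⟩
  refine Real.sSup_nonneg ?_
  rintro _ ⟨u, -, rfl⟩
  positivity

lemma sqrt_bergmanH_le {n : ℕ} {z : Fin n → ℂ} (hz : z ∈ polyDisc n) (u : Fin n → ℂ) :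
    Real.sqrt (bergmanH n z u) ≤ n * (‖u‖ / (1 - ‖z‖ ^ 2)) := by
  have hz1 : ‖z‖ < 1 := hz
  have h0 : 0 < 1 - ‖z‖ ^ 2 := by nlinarith [norm_nonneg z]
  refine Real.sqrt_le_iff.2 ⟨by positivity, ?_⟩
  have hsum : bergmanH n z u ≤ ∑ _j : Fin n, (‖u‖ / (1 - ‖z‖ ^ 2)) ^ 2 := by
    refine Finset.sum_le_sum fun j _ => ?_
    rw [div_pow]
    have hu := norm_le_pi_norm u j
    have hzj := norm_le_pi_norm z j
    gcongr
  have hn : (n : ℝ) ≤ (n : ℝ) ^ 2 := by exact_mod_cast Nat.le_self_pow two_ne_zero n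
  calc bergmanH n z u ≤ n * (‖u‖ / (1 - ‖z‖ ^ 2)) ^ 2 := by simpa using hsum
    _ ≤ (n : ℝ) ^ 2 * (‖u‖ / (1 - ‖z‖ ^ 2)) ^ 2 := by gcongr
    _ = _ := by ring

lemma hasDerivAt_half_log_sub_log {r t : ℝ} (h1 : 0 < 1 + t * r) (h2 : 0 < 1 - t * r) :
    HasDerivAt (fun t : ℝ => 1 / 2 * (Real.log (1 + t * r) - Real.log (1 - t * r)))
      (r / (1 - (t * r) ^ 2)) t := by
  have hlin : HasDerivAt (fun t : ℝ => t * r) r t := by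
    simpa using (hasDerivAt_id t).mul_const r
  refine ((((hlin.const_add 1).log h1.ne').sub ((hlin.const_sub 1).log h2.ne')).const_mul
    (1 / 2 : ℝ)).congr_deriv ?_
  have h3 : 1 - (t * r) ^ 2 = (1 + t * r) * (1 - t * r) := by ring
  have h1' := h1.ne'
  have h2' := h2.ne'
  rw [h3]
  generalize ha : 1 + t * r = a at *
  generalize hb : 1 - t * r = b at *
  field_simp
  linear_combination -r * ha - r * hb

/-- If `f` is holomorphic on the polydisc with finite Bloch seminorm
`‖f‖_B = sup_z Q_f(z)`, then for every `z ∈ Uⁿ`,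
`|f(z) - f(0)| ≤ n ‖f‖_B (1/2) log((1+|||z|||)/(1-|||z|||))`. -/
theorem bloch_growth_estimate (n : ℕ) (hn : 0 < n) (f : (Fin n → ℂ) → ℂ)
    (hf : DifferentiableOn ℂ f (polyDisc n))
    (hb : BddAbove (Qf n f '' polyDisc n))
    (z : Fin n → ℂ) (hz : z ∈ polyDisc n) :
    ‖f z - f 0‖ ≤ (n : ℝ) * blochSemiQ n f * ((1 / 2) * Real.log ((1 + ‖z‖) / (1 - ‖z‖))) := by
  have hz1 : ‖z‖ < 1 := hz
  have hr := norm_nonneg z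
  have htr : ∀ t ∈ Icc (0 : ℝ) 1, 0 ≤ t * ‖z‖ ∧ t * ‖z‖ < 1 := fun t ht =>
    ⟨mul_nonneg ht.1 hr, (mul_le_of_le_one_left hr ht.2).trans_lt hz1⟩
  have hnorm : ∀ t ∈ Icc (0 : ℝ) 1, ‖t • z‖ = t * ‖z‖ := fun t ht => by
    rw [norm_smul, Real.norm_of_nonneg ht.1]
  have hmem : ∀ t ∈ Icc (0 : ℝ) 1, t • z ∈ polyDisc n := fun t ht => by
    change ‖t • z‖ < 1
    rw [hnorm t ht]
    exact (htr t ht).2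
  have hopen : IsOpen (polyDisc n) := isOpen_lt continuous_norm continuous_const
  have hderiv : ∀ t ∈ Icc (0 : ℝ) 1,
      HasDerivAt (fun t : ℝ => f (t • z) - f 0) (fderiv ℂ f (t • z) z) t := fun t ht => by
    have hd := ((hf.differentiableAt (hopen.mem_nhds (hmem t ht))).hasFDerivAt).restrictScalars ℝ
    have hl : HasDerivAt (fun t : ℝ => t • z) z t := by
      simpa using (hasDerivAt_id t).smul_const z
    exact (hd.comp_hasDerivAt t hl).sub_const (f 0)
  have hbound : ∀ t ∈ Icc (0 : ℝ) 1, HasDerivAt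
      (fun t : ℝ => n * blochSemiQ n f *
        (1 / 2 * (Real.log (1 + t * ‖z‖) - Real.log (1 - t * ‖z‖))))
      (n * blochSemiQ n f * (‖z‖ / (1 - (t * ‖z‖) ^ 2))) t := fun t ht =>
    (hasDerivAt_half_log_sub_log (by linarith [(htr t ht).1])
      (by linarith [(htr t ht).2])).const_mul _
  have key := image_norm_le_of_norm_deriv_right_le_deriv_boundary'
    (fun t ht => (hderiv t ht).continuousAt.continuousWithinAt)
    (fun t ht => (hderiv t (Ico_subset_Icc_self ht)).hasDerivWithinAt)
    (by simp)
    (fun t ht => (hbound t ht).continuousAt.continuousWithinAt)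
    (fun t ht => (hbound t (Ico_subset_Icc_self ht)).hasDerivWithinAt)
    (fun t ht => by
      have ht' := Ico_subset_Icc_self ht
      calc ‖fderiv ℂ f (t • z) z‖
          ≤ Qf n f (t • z) * Real.sqrt (bergmanH n (t • z) z) :=
            norm_fderiv_le_Qf_mul f (hmem t ht') z
        _ ≤ blochSemiQ n f * (n * (‖z‖ / (1 - ‖t • z‖ ^ 2))) :=
            mul_le_mul (le_csSup hb ⟨_, hmem t ht', rfl⟩) (sqrt_bergmanH_le (hmem t ht') z)
              (Real.sqrt_nonneg _) (blochSemiQ_nonneg n f)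
        _ = n * blochSemiQ n f * (‖z‖ / (1 - (t * ‖z‖) ^ 2)) := by
            rw [hnorm t ht']
            ring)
    (right_mem_Icc.2 zero_le_one)
  rw [Real.log_div (by linarith) (by linarith)]
  simpa only [one_smul, one_mul] using key
end
end
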